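/- arXiv:2412.15466 — 2 statements merged into one kernel-verified Lean document; each statement's English description precedes it below -/
import Mathlib

section
/- Define P₀ = I, P₁ = X, P₂ = Z, P₃ = XZ and T = (1/√2)[[1, −i],[1, i]]. Let E : M₂(ℂ) → M₂(ℂ) be a linear map admitting a Kraus representation E(A) = Σ_k K_k A K_k† with Σ_k K_k† K_k = I (i.e., E is completely positive and trace preserving). Then there exists a real number η such that for every ρ ∈ M₂(ℂ), (1/12) Σ_{t<3} Σ_{i<4} (P_i T^t)† · E( (P_i T^t) ρ (P_i T^t)† ) · (P_i T^t) = (tr ρ / 2)·I + η·(ρ − (tr ρ / 2)·I); that is, the twirl of E by the twelve unitaries {P_i T^t} is a depolarizing channel, equivalently its Pauli–Liouville representation is diag(1, η, η, η). -/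
open Matrix
open scoped BigOperators

/-- The Pauli matrix `X`. -/
noncomputable def pauliX : Matrix (Fin 2) (Fin 2) ℂ := !![0, 1; 1, 0]

/-- The Pauli matrix `Z`. -/
noncomputable def pauliZ : Matrix (Fin 2) (Fin 2) ℂ := !![1, 0; 0, -1]

/-- The list of Pauli elements `P₀ = I`, `P₁ = X`, `P₂ = Z`, `P₃ = XZ`. -/
noncomputable def pauli : Fin 4 → Matrix (Fin 2) (Fin 2) ℂ :=
  ![1, pauliX, pauliZ, pauliX * pauliZ]

/-- The gate `T = (1/√2)[[1, −i],[1, i]]`. -/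
noncomputable def gateT : Matrix (Fin 2) (Fin 2) ℂ :=
  ((Real.sqrt 2 : ℂ))⁻¹ • !![1, -Complex.I; 1, Complex.I]

theorem map_fin_two (E : Matrix (Fin 2) (Fin 2) ℂ →ₗ[ℂ] Matrix (Fin 2) (Fin 2) ℂ) (a b c d : ℂ) :
    E !![a, b; c, d] = a • E !![1, 0; 0, 0] + b • E !![0, 1; 0, 0] +
      c • E !![0, 0; 1, 0] + d • E !![0, 0; 0, 1] := by
  simp only [← map_smul, ← map_add]
  congr 1
  ext i j
  fin_cases i <;> fin_cases j <;> simp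

theorem conjTranspose_fin_two (a b c d : ℂ) :
    !![a, b; c, d]ᴴ = !![star a, star c; star b, star d] := by
  ext i j
  fin_cases i <;> fin_cases j <;> simp

theorem conj_mul_smul_map (E : Matrix (Fin 2) (Fin 2) ℂ →ₗ[ℂ] Matrix (Fin 2) (Fin 2) ℂ)
    (z : ℂ) (P U ρ : Matrix (Fin 2) (Fin 2) ℂ) :
    (P * z • U)ᴴ * E ((P * z • U) * ρ * (P * z • U)ᴴ) * (P * z • U) =
      (star z * z) ^ 2 • ((P * U)ᴴ * E ((P * U) * ρ * (P * U)ᴴ) * (P * U)) := by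
  simp only [conjTranspose_smul, Matrix.smul_mul, Matrix.mul_smul, map_smul, smul_smul]
  congr 1
  ring

theorem star_inv_sqrt_two_mul_self :
    star ((Real.sqrt 2 : ℂ))⁻¹ * ((Real.sqrt 2 : ℂ))⁻¹ = 1 / 2 := by
  rw [← Complex.ofReal_inv, Complex.star_def, Complex.conj_ofReal, ← Complex.ofReal_mul,
    ← mul_inv, Real.mul_self_sqrt (by norm_num)]
  norm_num

theorem gateT_sq : gateT ^ 2 = (1 / 2 : ℂ) •
    !![1 - Complex.I, 1 - Complex.I; 1 + Complex.I, -1 - Complex.I] := by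
  have h : ((Real.sqrt 2 : ℂ))⁻¹ * ((Real.sqrt 2 : ℂ))⁻¹ = 1 / 2 := by
    simpa [← Complex.ofReal_inv] using star_inv_sqrt_two_mul_self
  rw [gateT, sq, Matrix.smul_mul, Matrix.mul_smul, smul_smul, h]
  congr 1
  ext i j
  fin_cases i <;> fin_cases j <;> simp [Matrix.mul_apply] <;> ring

set_option maxHeartbeats 4000000 in
/-- The twirl of a trace preserving linear map is depolarizing, with parameter determined by the
trace of the map. -/
theorem twirl_eq_depolarizing (E : Matrix (Fin 2) (Fin 2) ℂ →ₗ[ℂ] Matrix (Fin 2) (Fin 2) ℂ)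
    (hE : ∀ A, (E A).trace = A.trace) (ρ : Matrix (Fin 2) (Fin 2) ℂ) :
    (1 / 12 : ℂ) •
        ∑ t : Fin 3, ∑ i : Fin 4,
          (pauli i * gateT ^ (t : ℕ))ᴴ *
            E ((pauli i * gateT ^ (t : ℕ)) * ρ * (pauli i * gateT ^ (t : ℕ))ᴴ) *
            (pauli i * gateT ^ (t : ℕ))
      = (ρ.trace / 2) • (1 : Matrix (Fin 2) (Fin 2) ℂ) +
          ((E !![1, 0; 0, 0] 0 0 + E !![0, 1; 0, 0] 0 1 + E !![0, 0; 1, 0] 1 0 +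
            E !![0, 0; 0, 1] 1 1 - 1) / 3) •
          (ρ - (ρ.trace / 2) • (1 : Matrix (Fin 2) (Fin 2) ℂ)) := by
  have h₁ := hE !![1, 0; 0, 0]
  have h₂ := hE !![0, 1; 0, 0]
  have h₃ := hE !![0, 0; 1, 0]
  have h₄ := hE !![0, 0; 0, 1]
  have key := map_fin_two E
  generalize E !![1, 0; 0, 0] = A at *
  generalize E !![0, 1; 0, 0] = B at *
  generalize E !![0, 0; 1, 0] = C at *
  generalize E !![0, 0; 0, 1] = D at *
  rw [trace_fin_two] at h₁ h₂ h₃ h₄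
  simp only [trace_fin_two_of, add_zero, zero_add] at h₁ h₂ h₃ h₄
  rw [← eq_sub_iff_add_eq'] at h₁ h₂ h₃ h₄
  have hI := Complex.I_sq
  have hI3 := Complex.I_pow_three
  have hI4 := Complex.I_pow_four
  have hz : star (1 / 2 : ℂ) * (1 / 2) = 1 / 4 := by
    norm_num [Complex.star_def]
  rw [eta_fin_two A, eta_fin_two B, eta_fin_two C, eta_fin_two D] at key
  rw [eta_fin_two ρ]
  simp only [Fin.sum_univ_three, Fin.sum_univ_four, Fin.val_zero, Fin.val_one, Fin.val_two,
    pow_zero, pow_one, gateT_sq, mul_one]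
  simp only [gateT, conj_mul_smul_map, star_inv_sqrt_two_mul_self, hz]
  simp only [pauli, pauliX, pauliZ, one_fin_two, cons_val_zero, cons_val_one, cons_val,
    mul_fin_two, conjTranspose_fin_two, key, trace_fin_two_of, smul_of, smul_cons, smul_empty]
  ext i j
  fin_cases i <;> fin_cases j <;> simp [h₁, h₂, h₃, h₄] <;> ring_nf <;> simp only [hI, hI3, hI4] <;> ring_nf

theorem stmt4
    (E : Matrix (Fin 2) (Fin 2) ℂ →ₗ[ℂ] Matrix (Fin 2) (Fin 2) ℂ)
    (hE : ∃ (r : ℕ) (K : Fin r → Matrix (Fin 2) (Fin 2) ℂ),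
      (∀ A, E A = ∑ k, K k * A * (K k)ᴴ) ∧ ∑ k, (K k)ᴴ * K k = 1) :
    ∃ η : ℝ, ∀ ρ : Matrix (Fin 2) (Fin 2) ℂ,
      (1 / 12 : ℂ) •
          ∑ t : Fin 3, ∑ i : Fin 4,
            (pauli i * gateT ^ (t : ℕ))ᴴ *
              E ((pauli i * gateT ^ (t : ℕ)) * ρ * (pauli i * gateT ^ (t : ℕ))ᴴ) *
              (pauli i * gateT ^ (t : ℕ))
        = (ρ.trace / 2) • (1 : Matrix (Fin 2) (Fin 2) ℂ) +
            (η : ℂ) • (ρ - (ρ.trace / 2) • (1 : Matrix (Fin 2) (Fin 2) ℂ)) := by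
  obtain ⟨r, K, hK, hK1⟩ := hE
  have htr : ∀ A, (E A).trace = A.trace := by
    intro A
    rw [hK, trace_sum]
    simp_rw [fun k => trace_mul_cycle (K k) A (K k)ᴴ]
    rw [← trace_sum, ← Finset.sum_mul, hK1, Matrix.one_mul]
  refine ⟨(∑ k, Complex.normSq (K k).trace - 1) / 3, fun ρ => ?_⟩
  rw [twirl_eq_depolarizing E htr ρ]
  congr 2
  push_cast
  congr 2
  simp only [hK, Matrix.sum_apply, ← Finset.sum_add_distrib]
  refine Finset.sum_congr rfl fun k _ => ?_
  rw [Complex.normSq_eq_conj_mul_self, trace_fin_two]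
  simp [Matrix.mul_apply, Fin.sum_univ_two]
  ring
end

section
/- Define P₀ = I, P₁ = X, P₂ = Z, P₃ = XZ and T = (1/√2)[[1, −i],[1, i]]. For every linear map E : M₂(ℂ) → M₂(ℂ) and every ρ ∈ M₂(ℂ), the uniform average of U† E(U ρ U†) U over the twelve unitaries {P_i T^t : i < 4, t < 3} equals the Haar average over the full unitary group U(2): (1/12) Σ_{t<3} Σ_{i<4} (P_i T^t)† E((P_i T^t) ρ (P_i T^t)†) (P_i T^t) = ∫_{U(2)} U† E(U ρ U†) U dU, where the integral is with respect to the Haar probability measure on the 2×2 unitary group (entrywise Bochner integral). In particular, the set {P_i T^t} is a unitary 2-design for twirling. -/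
open Matrix MeasureTheory
open scoped BigOperators

/-- The group `U(2)` of `2 × 2` unitary complex matrices. -/
abbrev U2 := Matrix.unitaryGroup (Fin 2) ℂ

noncomputable instance : MeasurableSpace U2 := borel U2

instance : BorelSpace U2 := ⟨rfl⟩

theorem pauli_mem_unitaryGroup (i : Fin 4) : pauli i ∈ unitaryGroup (Fin 2) ℂ := by
  rw [mem_unitaryGroup_iff, star_eq_conjTranspose]
  fin_cases i <;> ext j k <;> fin_cases j <;> fin_cases k <;>
    simp [pauli, pauliX, pauliZ, mul_apply, Fin.sum_univ_two]

theorem inv_sqrt_two_mul_self : ((Real.sqrt 2 : ℂ))⁻¹ * ((Real.sqrt 2 : ℂ))⁻¹ = 1 / 2 := by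
  rw [← mul_inv, ← Complex.ofReal_mul, Real.mul_self_sqrt (by norm_num)]
  norm_num

theorem conjTranspose_gateT :
    gateTᴴ = ((Real.sqrt 2 : ℂ))⁻¹ • !![1, 1; Complex.I, -Complex.I] := by
  ext j k
  fin_cases j <;> fin_cases k <;> simp [gateT]

theorem gateT_mem_unitaryGroup : gateT ∈ unitaryGroup (Fin 2) ℂ := by
  rw [mem_unitaryGroup_iff, star_eq_conjTranspose, conjTranspose_gateT, gateT,
    smul_mul_smul_comm, inv_sqrt_two_mul_self]
  ext j k
  fin_cases j <;> fin_cases k <;> simp <;> norm_num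

/-- The map `ρ ↦ U† E(U ρ U†) U` obtained from `E` by conjugation with `U`. -/
noncomputable def twirl {n : Type*} [Fintype n] (E : Matrix n n ℂ →ₗ[ℂ] Matrix n n ℂ)
    (U ρ : Matrix n n ℂ) : Matrix n n ℂ :=
  Uᴴ * E (U * ρ * Uᴴ) * U

theorem twirl_mul {n : Type*} [Fintype n] (E : Matrix n n ℂ →ₗ[ℂ] Matrix n n ℂ)
    (V U ρ : Matrix n n ℂ) :
    twirl E (V * U) ρ = Uᴴ * twirl E V (U * ρ * Uᴴ) * U := by
  simp only [twirl, conjTranspose_mul, Matrix.mul_assoc]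

theorem continuous_twirl {n : Type*} [Fintype n] (E : Matrix n n ℂ →ₗ[ℂ] Matrix n n ℂ)
    (ρ : Matrix n n ℂ) : Continuous fun U => twirl E U ρ := by
  have hE : Continuous E := E.continuous_of_finiteDimensional
  unfold twirl
  fun_prop

theorem linearMap_fin_two_apply (E : Matrix (Fin 2) (Fin 2) ℂ →ₗ[ℂ] Matrix (Fin 2) (Fin 2) ℂ)
    (σ : Matrix (Fin 2) (Fin 2) ℂ) :
    E σ = σ 0 0 • E (single 0 0 1) + σ 0 1 • E (single 0 1 1)
      + σ 1 0 • E (single 1 0 1) + σ 1 1 • E (single 1 1 1) := by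
  simp only [← map_smul, ← map_add]
  congr 1
  ext j k
  fin_cases j <;> fin_cases k <;> simp

theorem conjTranspose_fin_two_s5 (x y z w : ℂ) :
    !![x, y; z, w]ᴴ = !![star x, star z; star y, star w] := by
  ext j k
  fin_cases j <;> fin_cases k <;> rfl

theorem sum_twirl_pauli
    (E : Matrix (Fin 2) (Fin 2) ℂ →ₗ[ℂ] Matrix (Fin 2) (Fin 2) ℂ) :
    ∃ p q r s : ℂ, ∀ σ : Matrix (Fin 2) (Fin 2) ℂ, ∑ i, twirl E (pauli i) σ =
      !![p * σ 0 0 + q * σ 1 1, r * σ 0 1 + s * σ 1 0;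
        s * σ 0 1 + r * σ 1 0, q * σ 0 0 + p * σ 1 1] := by
  refine ⟨2 * (E (single 0 0 1) 0 0 + E (single 1 1 1) 1 1),
    2 * (E (single 0 0 1) 1 1 + E (single 1 1 1) 0 0),
    2 * (E (single 0 1 1) 0 1 + E (single 1 0 1) 1 0),
    2 * (E (single 0 1 1) 1 0 + E (single 1 0 1) 0 1), fun σ => ?_⟩
  simp only [twirl, linearMap_fin_two_apply E (_ * _)]
  generalize E (single 0 0 1) = A
  generalize E (single 0 1 1) = B
  generalize E (single 1 0 1) = C
  generalize E (single 1 1 1) = D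
  simp only [Fin.sum_univ_four, pauli, pauliX, pauliZ]
  rw [eta_fin_two σ, eta_fin_two A, eta_fin_two B, eta_fin_two C, eta_fin_two D]
  ext j k
  fin_cases j <;> fin_cases k <;>
  · simp [conjTranspose_fin_two_s5]
    ring

theorem gateT_mul_mul_conjTranspose (x y z w : ℂ) :
    gateT * !![x, y; z, w] * gateTᴴ =
      !![(x + w + Complex.I * (y - z)) / 2, (x - w - Complex.I * (y + z)) / 2;
        (x - w + Complex.I * (y + z)) / 2, (x + w - Complex.I * (y - z)) / 2] := by
  rw [conjTranspose_gateT, gateT, Matrix.smul_mul, smul_mul_smul_comm, inv_sqrt_two_mul_self,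
    mul_fin_two, mul_fin_two]
  ext j k
  fin_cases j <;> fin_cases k <;>
  · simp
    ring_nf
    simp only [Complex.I_sq]
    ring

theorem conjTranspose_gateT_mul_mul (x y z w : ℂ) :
    gateTᴴ * !![x, y; z, w] * gateT =
      !![(x + y + z + w) / 2, Complex.I * (y + w - x - z) / 2;
        Complex.I * (x + y - z - w) / 2, (x - y - z + w) / 2] := by
  rw [conjTranspose_gateT, gateT, Matrix.smul_mul, smul_mul_smul_comm, inv_sqrt_two_mul_self,
    mul_fin_two, mul_fin_two]
  ext j k
  fin_cases j <;> fin_cases k <;>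
  · simp
    ring_nf
    try simp only [Complex.I_sq]
    try ring

theorem exists_average_twirl_eq
    (E : Matrix (Fin 2) (Fin 2) ℂ →ₗ[ℂ] Matrix (Fin 2) (Fin 2) ℂ) :
    ∃ α β : ℂ, ∀ ρ : Matrix (Fin 2) (Fin 2) ℂ,
      (1 / 12 : ℂ) • ∑ t : Fin 3, ∑ i : Fin 4, twirl E (pauli i * gateT ^ (t : ℕ)) ρ
        = α • ρ + (β * ρ.trace) • 1 := by
  obtain ⟨p, q, r, s, h⟩ := sum_twirl_pauli E
  refine ⟨(p - q + 2 * r) / 12, (p + 2 * q - r) / 12, fun ρ => ?_⟩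
  have hTT (σ : Matrix (Fin 2) (Fin 2) ℂ) :
      gateT ^ 2 * σ * (gateT ^ 2)ᴴ = gateT * (gateT * σ * gateTᴴ) * gateTᴴ := by
    simp only [pow_two, conjTranspose_mul, Matrix.mul_assoc]
  have hTT' (σ : Matrix (Fin 2) (Fin 2) ℂ) :
      (gateT ^ 2)ᴴ * σ * gateT ^ 2 = gateTᴴ * (gateTᴴ * σ * gateT) * gateT := by
    simp only [pow_two, conjTranspose_mul, Matrix.mul_assoc]
  simp only [twirl_mul, ← Matrix.mul_sum, ← Matrix.sum_mul, h]
  simp only [Fin.sum_univ_three, Fin.val_zero, Fin.val_one, Fin.val_two, pow_zero, pow_one,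
    conjTranspose_one, Matrix.mul_one, Matrix.one_mul, hTT, hTT']
  rw [eta_fin_two ρ]
  simp only [gateT_mul_mul_conjTranspose, conjTranspose_gateT_mul_mul, of_apply, cons_val',
    cons_val_zero, cons_val_one, cons_val_fin_one, trace_fin_two]
  ext j k
  fin_cases j <;> fin_cases k <;>
  · simp
    ring_nf
    simp only [Complex.I_sq, Complex.I_pow_four]
    ring

theorem integrable_twirl_apply (μ : Measure U2) [IsFiniteMeasure μ]
    (E : Matrix (Fin 2) (Fin 2) ℂ →ₗ[ℂ] Matrix (Fin 2) (Fin 2) ℂ)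
    (ρ : Matrix (Fin 2) (Fin 2) ℂ) (a b : Fin 2) :
    Integrable (fun U : U2 => twirl E (U : Matrix (Fin 2) (Fin 2) ℂ) ρ a b) μ := by
  have hc : Continuous fun U : Matrix (Fin 2) (Fin 2) ℂ => twirl E U ρ a b :=
    (continuous_twirl E ρ).matrix_elem a b
  have hK : IsCompact (Set.univ.pi fun _ : Fin 2 => Set.univ.pi fun _ : Fin 2 =>
      Metric.closedBall (0 : ℂ) 1) :=
    isCompact_univ_pi fun _ => isCompact_univ_pi fun _ => isCompact_closedBall _ _
  obtain ⟨C, hC⟩ := hK.exists_bound_of_continuousOn hc.continuousOn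
  refine Integrable.of_bound
    (hc.comp continuous_subtype_val).measurable.aestronglyMeasurable C
    (.of_forall fun U => hC _ fun i _ j _ => ?_)
  simpa using entry_norm_bound_of_unitary U.2 i j

theorem stmt5 (μ : Measure U2) [μ.IsHaarMeasure] [IsProbabilityMeasure μ]
    (E : Matrix (Fin 2) (Fin 2) ℂ →ₗ[ℂ] Matrix (Fin 2) (Fin 2) ℂ)
    (ρ : Matrix (Fin 2) (Fin 2) ℂ) (a b : Fin 2) :
    ((1 / 12 : ℂ) •
        ∑ t : Fin 3, ∑ i : Fin 4,
          (pauli i * gateT ^ (t : ℕ))ᴴ *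
            E ((pauli i * gateT ^ (t : ℕ)) * ρ * (pauli i * gateT ^ (t : ℕ))ᴴ) *
            (pauli i * gateT ^ (t : ℕ))) a b
      = ∫ U : U2,
          ((U : Matrix (Fin 2) (Fin 2) ℂ)ᴴ *
            E ((U : Matrix (Fin 2) (Fin 2) ℂ) * ρ * (U : Matrix (Fin 2) (Fin 2) ℂ)ᴴ) *
            (U : Matrix (Fin 2) (Fin 2) ℂ)) a b ∂μ := by
  obtain ⟨α, β, h⟩ := exists_average_twirl_eq E
  change ((1 / 12 : ℂ) • ∑ t : Fin 3, ∑ i : Fin 4, twirl E (pauli i * gateT ^ (t : ℕ)) ρ) a b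
    = ∫ U : U2, twirl E (U : Matrix (Fin 2) (Fin 2) ℂ) ρ a b ∂μ
  let g (t : Fin 3) (i : Fin 4) : U2 :=
    ⟨pauli i * gateT ^ (t : ℕ),
      mul_mem (pauli_mem_unitaryGroup i) (pow_mem gateT_mem_unitaryGroup _)⟩
  have hinv (t : Fin 3) (i : Fin 4) :
      ∫ U : U2, twirl E (↑(g t i * U) : Matrix (Fin 2) (Fin 2) ℂ) ρ a b ∂μ
        = ∫ U : U2, twirl E (U : Matrix (Fin 2) (Fin 2) ℂ) ρ a b ∂μ :=
    integral_mul_left_eq_self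
      (fun U : U2 => twirl E (U : Matrix (Fin 2) (Fin 2) ℂ) ρ a b) (g t i)
  have hint (t : Fin 3) (i : Fin 4) : Integrable
      (fun U : U2 => twirl E (↑(g t i * U) : Matrix (Fin 2) (Fin 2) ℂ) ρ a b) μ :=
    (integrable_twirl_apply μ E ρ a b).comp_mul_left (g t i)
  have hconst (U : U2) : (1 / 12 : ℂ) * ∑ t : Fin 3, ∑ i : Fin 4,
      twirl E (↑(g t i * U) : Matrix (Fin 2) (Fin 2) ℂ) ρ a b
        = (α • ρ + (β * ρ.trace) • 1) a b := by
    have hU : (U : Matrix (Fin 2) (Fin 2) ℂ)ᴴ * U = 1 := mem_unitaryGroup_iff'.1 U.2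
    have key : (1 / 12 : ℂ) • ∑ t : Fin 3, ∑ i : Fin 4,
        twirl E (↑(g t i * U) : Matrix (Fin 2) (Fin 2) ℂ) ρ
          = α • ρ + (β * ρ.trace) • 1 := by
      simp only [Submonoid.coe_mul, twirl_mul _ (g _ _ : Matrix (Fin 2) (Fin 2) ℂ),
        ← Matrix.mul_sum, ← Matrix.sum_mul]
      rw [← Matrix.smul_mul, ← Matrix.mul_smul, h, trace_mul_cycle, hU, Matrix.one_mul,
        Matrix.mul_add, Matrix.add_mul]
      simp only [Matrix.mul_smul, Matrix.smul_mul, Matrix.mul_one, hU]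
      rw [← Matrix.mul_assoc, ← Matrix.mul_assoc, hU, Matrix.one_mul, Matrix.mul_assoc, hU,
        Matrix.mul_one]
    rw [← key]
    simp [Matrix.sum_apply]
  calc _ = (α • ρ + (β * ρ.trace) • 1) a b := by rw [h]
    _ = ∫ U : U2, (1 / 12 : ℂ) * ∑ t : Fin 3, ∑ i : Fin 4,
        twirl E (↑(g t i * U) : Matrix (Fin 2) (Fin 2) ℂ) ρ a b ∂μ := by
      simp only [hconst, integral_const, probReal_univ, one_smul]
    _ = (1 / 12 : ℂ) * ∑ t : Fin 3, ∑ i : Fin 4,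
        ∫ U : U2, twirl E (↑(g t i * U) : Matrix (Fin 2) (Fin 2) ℂ) ρ a b ∂μ := by
      rw [integral_const_mul, integral_finsetSum _ fun t _ =>
        integrable_finsetSum _ fun i _ => hint t i]
      simp_rw [integral_finsetSum _ fun i _ => hint _ i]
    _ = _ := by
      simp only [hinv, Finset.sum_const, Finset.card_univ, Fintype.card_fin, nsmul_eq_mul]
      push_cast
      ring
end
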